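/- Let n ≥ 3, let R be a commutative ring, and let A,B be ideals of R. Then E(n,R,A·B) ≤ [E(n,R,A), E(n,R,B)] ≤ [SL(n,R,A), SL(n,R,B)] ≤ SL(n,R,A·B), where A·B is the product ideal. -/

import Mathlib

open Matrix

/-- The elementary transvection `e + ξ e_{ij}` as an element of `SL(n,R)`. -/
def elemT {n : ℕ} {R : Type*} [CommRing R] (i j : Fin n) (hij : i ≠ j) (ξ : R) :
    Matrix.SpecialLinearGroup (Fin n) R :=
  ⟨Matrix.transvection i j ξ, Matrix.det_transvection_of_ne i j hij ξ⟩

/-- The set of elementary transvections in `SL(n,R)`. -/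
def elemSet (n : ℕ) (R : Type*) [CommRing R] :
    Set (Matrix.SpecialLinearGroup (Fin n) R) :=
  { g | ∃ i j : Fin n, ∃ hij : i ≠ j, ∃ ξ : R, g = elemT i j hij ξ }

/-- The elementary subgroup `E(n,R)` of `SL(n,R)`. -/
def elemSubgroup (n : ℕ) (R : Type*) [CommRing R] :
    Subgroup (Matrix.SpecialLinearGroup (Fin n) R) :=
  Subgroup.closure (elemSet n R)

/-- The set of elementary transvections of level `I`. -/
def elemSetIdeal (n : ℕ) {R : Type*} [CommRing R] (I : Ideal R) :
    Set (Matrix.SpecialLinearGroup (Fin n) R) :=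
  { g | ∃ i j : Fin n, ∃ hij : i ≠ j, ∃ ξ : R, ξ ∈ I ∧ g = elemT i j hij ξ }

/-- The subgroup `E(n,I)` generated by the elementary transvections of level `I`. -/
def elemSubgroupIdeal (n : ℕ) {R : Type*} [CommRing R] (I : Ideal R) :
    Subgroup (Matrix.SpecialLinearGroup (Fin n) R) :=
  Subgroup.closure (elemSetIdeal n I)

/-- The relative elementary subgroup `E(n,R,I)`: the normal closure of `E(n,I)`
in `E(n,R)`. -/
def relElemSubgroup (n : ℕ) {R : Type*} [CommRing R] (I : Ideal R) :
    Subgroup (Matrix.SpecialLinearGroup (Fin n) R) :=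
  Subgroup.closure
    { g | ∃ h ∈ elemSubgroup n R, ∃ x ∈ elemSubgroupIdeal n I, g = h * x * h⁻¹ }

/-- The principal congruence subgroup `SL(n,R,I)`: the kernel of reduction modulo `I`. -/
def congrSubgroup (n : ℕ) {R : Type*} [CommRing R] (I : Ideal R) :
    Subgroup (Matrix.SpecialLinearGroup (Fin n) R) :=
  (Matrix.SpecialLinearGroup.map (Ideal.Quotient.mk I)).ker

/-- The elementary generator `z_{ij}(ξ,ζ) = t_{ji}(ζ) t_{ij}(ξ) t_{ji}(−ζ)` of the
relative elementary subgroup. -/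
def zElem {n : ℕ} {R : Type*} [CommRing R] (i j : Fin n) (hij : i ≠ j) (ξ ζ : R) :
    Matrix.SpecialLinearGroup (Fin n) R :=
  elemT j i hij.symm ζ * elemT i j hij ξ * elemT j i hij.symm (-ζ)

/-- The set of elementary generators `z_{ij}(ξ,ζ)`, `ξ ∈ I`, `ζ ∈ R`, of `E(n,R,I)`. -/
def zSet (n : ℕ) {R : Type*} [CommRing R] (I : Ideal R) :
    Set (Matrix.SpecialLinearGroup (Fin n) R) :=
  { g | ∃ i j : Fin n, ∃ hij : i ≠ j, ∃ ξ ∈ I, ∃ ζ : R, g = zElem i j hij ξ ζ }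

section Auxiliary

open scoped commutatorElement

variable {n : ℕ} {R : Type*} [CommRing R]

theorem coe_elemT {i j : Fin n} (hij : i ≠ j) (ξ : R) :
    (elemT i j hij ξ : Matrix (Fin n) (Fin n) R) = 1 + single i j ξ :=
  rfl

theorem elemT_add {i j : Fin n} (hij : i ≠ j) (ξ ζ : R) :
    elemT i j hij (ξ + ζ) = elemT i j hij ξ * elemT i j hij ζ :=
  Matrix.SpecialLinearGroup.transvection_add hij ξ ζ

/-- The Steinberg relation `[t_{ih}(a), t_{hj}(b)] = t_{ij}(ab)`. -/
theorem commutatorElement_elemT {i h j : Fin n} (hih : i ≠ h) (hhj : h ≠ j) (hij : i ≠ j)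
    (a b : R) : ⁅elemT i h hih a, elemT h j hhj b⁆ = elemT i j hij (a * b) := by
  rw [commutatorElement_def, mul_inv_eq_iff_eq_mul, mul_inv_eq_iff_eq_mul]
  apply Subtype.ext
  change (elemT i h hih a * elemT h j hhj b : Matrix (Fin n) (Fin n) R) =
    elemT i j hij (a * b) * elemT h j hhj b * elemT i h hih a
  simp [coe_elemT, mul_add, add_mul, hhj.symm, hij.symm]
  abel

theorem elemT_mem_relElemSubgroup {I : Ideal R} {i j : Fin n} (hij : i ≠ j) {ξ : R}
    (hξ : ξ ∈ I) : elemT i j hij ξ ∈ relElemSubgroup n I :=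
  Subgroup.subset_closure
    ⟨1, one_mem _, _, Subgroup.subset_closure ⟨i, j, hij, ξ, hξ, rfl⟩, by simp⟩

theorem map_conj_relElemSubgroup_le (I : Ideal R) {h : Matrix.SpecialLinearGroup (Fin n) R}
    (hh : h ∈ elemSubgroup n R) :
    (relElemSubgroup n I).map (MulAut.conj h).toMonoidHom ≤ relElemSubgroup n I := by
  rw [relElemSubgroup, MonoidHom.map_closure, Subgroup.closure_le]
  rintro _ ⟨_, ⟨k, hk, x, hx, rfl⟩, rfl⟩
  exact Subgroup.subset_closure ⟨h * k, mul_mem hh hk, x, hx, by simp [mul_assoc]⟩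

theorem conj_mem_commutator_relElemSubgroup (A B : Ideal R)
    {h x : Matrix.SpecialLinearGroup (Fin n) R} (hh : h ∈ elemSubgroup n R)
    (hx : x ∈ ⁅relElemSubgroup n A, relElemSubgroup n B⁆) :
    h * x * h⁻¹ ∈ ⁅relElemSubgroup n A, relElemSubgroup n B⁆ := by
  have hmap := Subgroup.mem_map_of_mem (MulAut.conj h).toMonoidHom hx
  rw [Subgroup.map_commutator] at hmap
  exact Subgroup.commutator_mono (map_conj_relElemSubgroup_le A hh)
    (map_conj_relElemSubgroup_le B hh) hmap

theorem elemT_mem_commutator_relElemSubgroup (hn : 3 ≤ n) {A B : Ideal R} {i j : Fin n}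
    (hij : i ≠ j) {ξ : R} (hξ : ξ ∈ A * B) :
    elemT i j hij ξ ∈ ⁅relElemSubgroup n A, relElemSubgroup n B⁆ := by
  obtain ⟨h, hh⟩ := Finset.exists_mem_notMem_of_card_lt_card
    (s := {i, j}) (t := (Finset.univ : Finset (Fin n)))
    (Finset.card_le_two.trans_lt (by rwa [Finset.card_fin]))
  obtain ⟨hhi, hhj⟩ : h ≠ i ∧ h ≠ j := by simpa using hh
  induction hξ using Submodule.mul_induction_on' with
  | mem_mul_mem a ha b hb =>
    rw [← commutatorElement_elemT hhi.symm hhj hij]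
    exact Subgroup.commutator_mem_commutator (elemT_mem_relElemSubgroup _ ha)
      (elemT_mem_relElemSubgroup _ hb)
  | add x _ y _ hx hy =>
    rw [elemT_add]
    exact mul_mem hx hy

theorem relElemSubgroup_mul_le_commutator (hn : 3 ≤ n) (A B : Ideal R) :
    relElemSubgroup n (A * B) ≤ ⁅relElemSubgroup n A, relElemSubgroup n B⁆ := by
  have hle : elemSubgroupIdeal n (A * B) ≤ ⁅relElemSubgroup n A, relElemSubgroup n B⁆ := by
    rw [elemSubgroupIdeal, Subgroup.closure_le]
    rintro _ ⟨i, j, hij, ξ, hξ, rfl⟩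
    exact elemT_mem_commutator_relElemSubgroup hn hij hξ
  rw [relElemSubgroup, Subgroup.closure_le]
  rintro _ ⟨h, hh, x, hx, rfl⟩
  exact conj_mem_commutator_relElemSubgroup A B hh (hle hx)

theorem mem_congrSubgroup_iff {I : Ideal R} {x : Matrix.SpecialLinearGroup (Fin n) R} :
    x ∈ congrSubgroup n I ↔ ∀ i j, (x - 1 : Matrix (Fin n) (Fin n) R) i j ∈ I := by
  rw [congrSubgroup, MonoidHom.mem_ker, Matrix.SpecialLinearGroup.ext_iff]
  refine forall₂_congr fun i j => ?_
  rw [← Ideal.Quotient.eq_zero_iff_mem, Matrix.sub_apply, map_sub, sub_eq_zero]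
  by_cases hij : i = j <;> simp [Matrix.one_apply, hij]

theorem relElemSubgroup_le_congrSubgroup (I : Ideal R) :
    relElemSubgroup n I ≤ congrSubgroup n I := by
  have hle : elemSubgroupIdeal n I ≤ congrSubgroup n I := by
    rw [elemSubgroupIdeal, Subgroup.closure_le]
    rintro _ ⟨i, j, hij, ξ, hξ, rfl⟩
    refine mem_congrSubgroup_iff.2 fun k l => ?_
    by_cases hkl : i = k ∧ j = l <;> simp [coe_elemT, hkl, hξ]
  rw [relElemSubgroup, Subgroup.closure_le]
  rintro _ ⟨h, -, x, hx, rfl⟩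
  exact (MonoidHom.normal_ker _).conj_mem x (hle hx) h

theorem mul_apply_mem_mul {A B : Ideal R} {X Y : Matrix (Fin n) (Fin n) R}
    (hX : ∀ i j, X i j ∈ A) (hY : ∀ i j, Y i j ∈ B) (i j : Fin n) :
    (X * Y) i j ∈ A * B := by
  rw [Matrix.mul_apply]
  exact Ideal.sum_mem _ fun k _ => Ideal.mul_mem_mul (hX i k) (hY k j)

theorem commutator_congrSubgroup_le (A B : Ideal R) :
    ⁅congrSubgroup n A, congrSubgroup n B⁆ ≤ congrSubgroup n (A * B) := by
  rw [Subgroup.commutator_le]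
  intro x hx y hy
  rw [mem_congrSubgroup_iff] at hx hy
  rw [congrSubgroup, MonoidHom.mem_ker, map_commutatorElement,
    commutatorElement_eq_one_iff_mul_comm, ← map_mul, ← map_mul]
  ext i j
  have hxy : (x * y - y * x : Matrix (Fin n) (Fin n) R) =
      (x - 1 : Matrix (Fin n) (Fin n) R) * (y - 1) - (y - 1) * (x - 1) := by
    noncomm_ring
  refine (Ideal.Quotient.mk_eq_mk_iff_sub_mem _ _).2 ?_
  rw [Matrix.SpecialLinearGroup.coe_mul, Matrix.SpecialLinearGroup.coe_mul, ← Matrix.sub_apply,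
    hxy, Matrix.sub_apply]
  exact sub_mem (mul_apply_mem_mul hx hy i j)
    (Ideal.mul_comm B A ▸ mul_apply_mem_mul hy hx i j)

end Auxiliary

/-- For n ≥ 3 and ideals A, B of R:
E(n,R,AB) ≤ [E(n,R,A), E(n,R,B)] ≤ [SL(n,R,A), SL(n,R,B)] ≤ SL(n,R,AB). -/
theorem mixed_commutator_level (n : ℕ) (hn : 3 ≤ n)
    (R : Type*) [CommRing R] (A B : Ideal R) :
    relElemSubgroup n (A * B) ≤ ⁅relElemSubgroup n A, relElemSubgroup n B⁆ ∧
      ⁅relElemSubgroup n A, relElemSubgroup n B⁆ ≤ ⁅congrSubgroup n A, congrSubgroup n B⁆ ∧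
      ⁅congrSubgroup n A, congrSubgroup n B⁆ ≤ congrSubgroup n (A * B) := by
  exact ⟨relElemSubgroup_mul_le_commutator hn A B,
    Subgroup.commutator_mono (relElemSubgroup_le_congrSubgroup A)
      (relElemSubgroup_le_congrSubgroup B),
    commutator_congrSubgroup_le A B⟩
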